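/- For every formula ψ: the sequent ⇒ □ψ is derivable in SC_TML if and only if the sequent ⇒ ψ is derivable in SC_TML (i.e., □ψ is a theorem of the tetravalent modal logic TML if and only if ψ is). -/

import Mathlib

/-- Formulas built from propositional variables by the connectives `∧`, `∨`, `¬`, `□`
(no `⊥`). -/
inductive Formula : Type where
  | var : ℕ → Formula
  | and : Formula → Formula → Formula
  | or : Formula → Formula → Formula
  | neg : Formula → Formula
  | box : Formula → Formula
deriving DecidableEq
/-- The two-sided sequent calculus `SC_TML`.  `SCder c Γ Δ` means the sequent `Γ ⇒ Δ`
has a derivation; when `c = false` the cut rule is not allowed (cut-free derivability),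
`SCder true` is plain derivability. -/
inductive SCder : Bool → Finset Formula → Finset Formula → Prop where
  | ax (c : Bool) (α : Formula) : SCder c {α} {α}
  | weakL {c Γ Δ} (α : Formula) : SCder c Γ Δ → SCder c (insert α Γ) Δ
  | weakR {c Γ Δ} (α : Formula) : SCder c Γ Δ → SCder c Γ (insert α Δ)
  | cut {Γ Δ : Finset Formula} {α : Formula} :
      SCder true Γ (insert α Δ) → SCder true (insert α Γ) Δ → SCder true Γ Δ
  | andL {c Γ Δ} (α β : Formula) :
      SCder c (insert α (insert β Γ)) Δ → SCder c (insert (α.and β) Γ) Δ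
  | andR {c Γ Δ} (α β : Formula) :
      SCder c Γ (insert α Δ) → SCder c Γ (insert β Δ) → SCder c Γ (insert (α.and β) Δ)
  | nandL {c Γ Δ} (α β : Formula) :
      SCder c (insert α.neg Γ) Δ → SCder c (insert β.neg Γ) Δ →
      SCder c (insert (α.and β).neg Γ) Δ
  | nandR {c Γ Δ} (α β : Formula) :
      SCder c Γ (insert α.neg (insert β.neg Δ)) → SCder c Γ (insert (α.and β).neg Δ)
  | orL {c Γ Δ} (α β : Formula) :
      SCder c (insert α Γ) Δ → SCder c (insert β Γ) Δ → SCder c (insert (α.or β) Γ) Δ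
  | orR {c Γ Δ} (α β : Formula) :
      SCder c Γ (insert α (insert β Δ)) → SCder c Γ (insert (α.or β) Δ)
  | norL {c Γ Δ} (α β : Formula) :
      SCder c (insert α.neg (insert β.neg Γ)) Δ → SCder c (insert (α.or β).neg Γ) Δ
  | norR {c Γ Δ} (α β : Formula) :
      SCder c Γ (insert α.neg Δ) → SCder c Γ (insert β.neg Δ) →
      SCder c Γ (insert (α.or β).neg Δ)
  | nnL {c Γ Δ} (α : Formula) : SCder c (insert α Γ) Δ → SCder c (insert α.neg.neg Γ) Δ
  | nnR {c Γ Δ} (α : Formula) : SCder c Γ (insert α Δ) → SCder c Γ (insert α.neg.neg Δ)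
  | boxL1 {c Γ Δ} (α : Formula) : SCder c (insert α Γ) Δ → SCder c (insert α.box Γ) Δ
  | boxL2 {c Γ Δ} (α : Formula) : SCder c Γ (insert α.neg Δ) → SCder c (insert α.box Γ) Δ
  | boxR {c Γ Δ} (α : Formula) :
      SCder c Γ (insert α Δ) → SCder c (insert α.neg Γ) Δ → SCder c Γ (insert α.box Δ)
  | nboxL {c Γ Δ} (α : Formula) :
      SCder c Γ (insert α Δ) → SCder c (insert α.neg Γ) Δ → SCder c (insert α.box.neg Γ) Δ
  | nboxR1 {c Γ Δ} (α : Formula) : SCder c (insert α Γ) Δ → SCder c Γ (insert α.box.neg Δ)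
  | nboxR2 {c Γ Δ} (α : Formula) : SCder c Γ (insert α.neg Δ) → SCder c Γ (insert α.box.neg Δ)

open Finset

namespace SCder

theorem weaken_left {c : Bool} {Γ Δ : Finset Formula} (Θ : Finset Formula) (h : SCder c Γ Δ) :
    SCder c (Θ ∪ Γ) Δ := by
  induction Θ using Finset.induction_on with
  | empty => simpa using h
  | insert α Θ _ ih => rw [insert_union]; exact ih.weakL α

theorem weaken_right {c : Bool} {Γ Δ : Finset Formula} (Θ : Finset Formula) (h : SCder c Γ Δ) :
    SCder c Γ (Θ ∪ Δ) := by
  induction Θ using Finset.induction_on with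
  | empty => simpa using h
  | insert α Θ _ ih => rw [insert_union]; exact ih.weakR α

theorem of_mem {c : Bool} {Γ Δ : Finset Formula} {α : Formula} (hΓ : α ∈ Γ) (hΔ : α ∈ Δ) :
    SCder c Γ Δ := by
  have h := ((ax c α).weaken_left Γ).weaken_right Δ
  rwa [union_eq_left.2 (singleton_subset_iff.2 hΓ),
    union_eq_left.2 (singleton_subset_iff.2 hΔ)] at h

theorem of_neg_neg_right {Γ Δ : Finset Formula} {α : Formula}
    (h : SCder true Γ (insert α.neg.neg Δ)) : SCder true Γ (insert α Δ) := by
  refine cut (α := α.neg.neg) ?_ (nnL α (of_mem (mem_insert_self _ _) (mem_insert_self _ _)))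
  rw [insert_comm]
  exact h.weakR α

theorem of_neg_neg_left {Γ Δ : Finset Formula} {α : Formula}
    (h : SCder true (insert α.neg.neg Γ) Δ) : SCder true (insert α Γ) Δ := by
  refine cut (α := α.neg.neg) (nnR α (of_mem (mem_insert_self _ _) (mem_insert_self _ _))) ?_
  rw [insert_comm]
  exact h.weakL α

/-- Contraposition: negating both sides of a derivable sequent and exchanging them gives a
derivable sequent. -/
theorem contrapose {c : Bool} {Γ Δ : Finset Formula} (h : SCder c Γ Δ) :
    SCder true (Δ.image Formula.neg) (Γ.image Formula.neg) := by
  induction h with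
  | ax c α => simpa using ax true α.neg
  | weakL α _ ih => simpa only [image_insert] using ih.weakR α.neg
  | weakR α _ ih => simpa only [image_insert] using ih.weakL α.neg
  | cut _ _ ih₁ ih₂ =>
    rw [image_insert] at ih₁ ih₂
    exact cut ih₂ ih₁
  | andL α β _ ih =>
    simp only [image_insert] at ih ⊢
    exact nandR α β ih
  | andR α β _ _ ih₁ ih₂ =>
    simp only [image_insert] at ih₁ ih₂ ⊢
    exact nandL α β ih₁ ih₂
  | nandL α β _ _ ih₁ ih₂ =>
    simp only [image_insert] at ih₁ ih₂ ⊢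
    exact nnR _ (andR α β ih₁.of_neg_neg_right ih₂.of_neg_neg_right)
  | nandR α β _ ih =>
    simp only [image_insert] at ih ⊢
    have h := ih.of_neg_neg_left
    rw [insert_comm] at h
    have h' := h.of_neg_neg_left
    rw [insert_comm] at h'
    exact nnL _ (andL α β h')
  | orL α β _ _ ih₁ ih₂ =>
    simp only [image_insert] at ih₁ ih₂ ⊢
    exact norR α β ih₁ ih₂
  | orR α β _ ih =>
    simp only [image_insert] at ih ⊢
    exact norL α β ih
  | norL α β _ ih =>
    simp only [image_insert] at ih ⊢
    have h := ih.of_neg_neg_right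
    rw [insert_comm] at h
    have h' := h.of_neg_neg_right
    rw [insert_comm] at h'
    exact nnR _ (orR α β h')
  | norR α β _ _ ih₁ ih₂ =>
    simp only [image_insert] at ih₁ ih₂ ⊢
    exact nnL _ (orL α β ih₁.of_neg_neg_left ih₂.of_neg_neg_left)
  | nnL α _ ih =>
    simp only [image_insert] at ih ⊢
    exact nnR _ ih
  | nnR α _ ih =>
    simp only [image_insert] at ih ⊢
    exact nnL _ ih
  | boxL1 α _ ih =>
    simp only [image_insert] at ih ⊢
    exact nboxR2 α ih
  | boxL2 α _ ih =>
    simp only [image_insert] at ih ⊢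
    exact nboxR1 α ih.of_neg_neg_left
  | boxR α _ _ ih₁ ih₂ =>
    simp only [image_insert] at ih₁ ih₂ ⊢
    exact nboxL α ih₂.of_neg_neg_right ih₁
  | nboxL α _ _ ih₁ ih₂ =>
    simp only [image_insert] at ih₁ ih₂ ⊢
    exact nnR _ (boxR α ih₂.of_neg_neg_right ih₁)
  | nboxR1 α _ ih =>
    simp only [image_insert] at ih ⊢
    exact nnL _ (boxL2 α ih)
  | nboxR2 α _ ih =>
    simp only [image_insert] at ih ⊢
    exact nnL _ (boxL1 α ih.of_neg_neg_left)

end SCder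

/-- `□ψ` is a theorem of `TML` iff `ψ` is. -/
theorem sc_box_theorem_iff (ψ : Formula) :
    SCder true ∅ {ψ.box} ↔ SCder true ∅ {ψ} := by
  constructor <;> intro h
  · refine SCder.cut (α := ψ.box) ?_ (SCder.boxL1 ψ (SCder.of_mem (α := ψ) (by simp) (by simp)))
    rw [Finset.pair_comm]
    exact h.weakR ψ
  · have hneg : SCder true {ψ.neg} ∅ := by simpa using h.contrapose
    exact SCder.boxR (Γ := ∅) (Δ := ∅) ψ h hneg
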